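/- Let ξ ∈ (0,1) and let λ, ρ be degree distributions satisfying the successful decoding condition ξ·λ(1−ρ(1−x)) < x for all x ∈ (0, ξ]. Set b = ∫₀¹ ρ(x) dx, R = 1 − (∫₀¹ρ)/(∫₀¹λ), ΔR = (1−ξ) − R. Then for every x ∈ (0, ξ): x − ξ·λ(1−ρ(1−x)) ≤ √( −2·b·ΔR / ((ξ+ΔR)·(d/dx)[ρ(1−x)]) ) = √( 2·b·ΔR / ((ξ+ΔR)·ρ'(1−x)) ). -/

import Mathlib

open scoped BigOperators

/-- A degree distribution: a real polynomial `γ(x) = ∑_{i=2}^{D} γ_i x^(i-1)` whose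
coefficients are nonnegative and sum to `1`; `D` (the largest index with `γ_D ≠ 0`)
is called the maximal degree. -/
structure DegreeDist where
  c : ℕ → ℝ
  D : ℕ
  two_le_D : 2 ≤ D
  nonneg : ∀ i, 0 ≤ c i
  supp : ∀ i, c i ≠ 0 → 2 ≤ i ∧ i ≤ D
  cD_ne : c D ≠ 0
  sum_eq_one : ∑ i ∈ Finset.Icc 2 D, c i = 1

/-- Evaluation of a degree distribution at a real `x`. -/
noncomputable def DegreeDist.eval (γ : DegreeDist) (x : ℝ) : ℝ :=
  ∑ i ∈ Finset.Icc 2 γ.D, γ.c i * x ^ (i - 1)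

namespace DegreeDist

/-- The formal derivative of a degree distribution. -/
noncomputable def derivEval (γ : DegreeDist) (x : ℝ) : ℝ :=
  ∑ i ∈ Finset.Icc 2 γ.D, γ.c i * (((i - 1 : ℕ) : ℝ) * x ^ (i - 1 - 1))

variable (γ : DegreeDist)

lemma eval_zero : γ.eval 0 = 0 := by
  refine Finset.sum_eq_zero fun i hi => ?_
  have : i - 1 ≠ 0 := by have := (Finset.mem_Icc.mp hi).1; omega
  simp [this]

lemma eval_one : γ.eval 1 = 1 := by
  simpa [eval] using γ.sum_eq_one

lemma c_D_pos : 0 < γ.c γ.D := lt_of_le_of_ne (γ.nonneg _) γ.cD_ne.symm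

lemma D_mem_Icc : γ.D ∈ Finset.Icc 2 γ.D := Finset.mem_Icc.mpr ⟨γ.two_le_D, le_rfl⟩

lemma eval_pos {x : ℝ} (hx : 0 < x) : 0 < γ.eval x :=
  Finset.sum_pos' (fun i _ => mul_nonneg (γ.nonneg i) (by positivity))
    ⟨γ.D, γ.D_mem_Icc, mul_pos γ.c_D_pos (by positivity)⟩

lemma derivEval_pos {x : ℝ} (hx : 0 < x) : 0 < γ.derivEval x := by
  refine Finset.sum_pos' (fun i _ => mul_nonneg (γ.nonneg i) (by positivity))
    ⟨γ.D, γ.D_mem_Icc, mul_pos γ.c_D_pos (mul_pos ?_ (by positivity))⟩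
  have := γ.two_le_D
  exact_mod_cast (by omega : 0 < γ.D - 1)

lemma derivEval_nonneg {x : ℝ} (hx : 0 ≤ x) : 0 ≤ γ.derivEval x :=
  Finset.sum_nonneg fun i _ => mul_nonneg (γ.nonneg i) (by positivity)

lemma eval_le_eval {x y : ℝ} (hx : 0 ≤ x) (hxy : x ≤ y) : γ.eval x ≤ γ.eval y :=
  Finset.sum_le_sum fun i _ => mul_le_mul_of_nonneg_left (by gcongr) (γ.nonneg i)

lemma derivEval_le_derivEval {x y : ℝ} (hx : 0 ≤ x) (hxy : x ≤ y) :
    γ.derivEval x ≤ γ.derivEval y :=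
  Finset.sum_le_sum fun i _ => mul_le_mul_of_nonneg_left (by gcongr) (γ.nonneg i)

lemma hasDerivAt_eval (x : ℝ) : HasDerivAt γ.eval (γ.derivEval x) x :=
  HasDerivAt.fun_sum fun i _ => (hasDerivAt_pow (i - 1) x).const_mul (γ.c i)

@[fun_prop]
lemma continuous_eval : Continuous γ.eval := by
  unfold eval; fun_prop

@[fun_prop]
lemma continuous_derivEval : Continuous γ.derivEval := by
  unfold derivEval; fun_prop

lemma integral_eval_pos : 0 < ∫ x in (0:ℝ)..1, γ.eval x :=
  intervalIntegral.intervalIntegral_pos_of_pos_on (γ.continuous_eval.intervalIntegrable _ _)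
    (fun _ hx => γ.eval_pos hx.1) one_pos

lemma hasDerivAt_one_sub_eval_one_sub (x : ℝ) :
    HasDerivAt (fun y => 1 - γ.eval (1 - y)) (γ.derivEval (1 - x)) x := by
  have h := ((γ.hasDerivAt_eval (1 - x)).comp x ((hasDerivAt_id x).const_sub 1)).const_sub 1
  simpa [Function.comp_def] using h

lemma integral_id_mul_derivEval :
    ∫ x in (0:ℝ)..1, x * γ.derivEval (1 - x) = ∫ x in (0:ℝ)..1, γ.eval x := by
  have hc : Continuous fun x => γ.derivEval (1 - x) := by fun_prop
  have h := intervalIntegral.integral_mul_deriv_eq_deriv_mul (a := (0:ℝ)) (b := 1)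
    (u := fun x => x) (u' := fun _ => 1) (v := fun y => -γ.eval (1 - y))
    (v' := fun x => γ.derivEval (1 - x))
    (fun x _ => hasDerivAt_id x)
    (fun x _ => by simpa using (γ.hasDerivAt_one_sub_eval_one_sub x).sub_const 1)
    (by simp) (hc.intervalIntegrable _ _)
  rw [h]
  simp [γ.eval_zero, intervalIntegral.integral_comp_sub_left (fun x => γ.eval x)]

lemma integral_comp_mul_derivEval (lam : DegreeDist) :
    ∫ x in (0:ℝ)..1, lam.eval (1 - γ.eval (1 - x)) * γ.derivEval (1 - x) =
      ∫ x in (0:ℝ)..1, lam.eval x := by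
  have hc : Continuous fun x => γ.derivEval (1 - x) := by fun_prop
  have h := intervalIntegral.integral_comp_mul_deriv (a := (0:ℝ)) (b := 1) (g := lam.eval)
    (fun x _ => γ.hasDerivAt_one_sub_eval_one_sub x) hc.continuousOn lam.continuous_eval
  simpa [Function.comp_def, γ.eval_zero, γ.eval_one] using h

/-- The area between the two EXIT curves, written in the variable of the decoding gap. -/
lemma integral_gap (lam : DegreeDist) (ξ : ℝ) :
    ∫ x in (0:ℝ)..1, (x - ξ * lam.eval (1 - γ.eval (1 - x))) * γ.derivEval (1 - x) =
      (∫ x in (0:ℝ)..1, γ.eval x) - ξ * ∫ x in (0:ℝ)..1, lam.eval x := by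
  rw [← γ.integral_id_mul_derivEval, ← γ.integral_comp_mul_derivEval lam,
    ← intervalIntegral.integral_const_mul, ← intervalIntegral.integral_sub]
  · congr 1; ext x; ring
  · exact Continuous.intervalIntegrable (by fun_prop) _ _
  · exact Continuous.intervalIntegrable (by fun_prop) _ _

end DegreeDist

/-- `x − ξλ(1−ρ(1−x)) ≤ √(2bΔR/((ξ+ΔR)·ρ'(1−x)))` on `(0, ξ)`. -/
theorem stmt9 (ξ b R dR : ℝ) (hξ : ξ ∈ Set.Ioo (0:ℝ) 1) (lam ρ : DegreeDist)
    (hdec : ∀ x ∈ Set.Ioc (0:ℝ) ξ, ξ * lam.eval (1 - ρ.eval (1 - x)) < x)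
    (hb : b = ∫ x in (0:ℝ)..1, ρ.eval x)
    (hR : R = 1 - (∫ x in (0:ℝ)..1, ρ.eval x) / (∫ x in (0:ℝ)..1, lam.eval x))
    (hdR : dR = (1 - ξ) - R) :
    ∀ x ∈ Set.Ioo (0:ℝ) ξ,
      x - ξ * lam.eval (1 - ρ.eval (1 - x)) ≤
        Real.sqrt (2 * b * dR / ((ξ + dR) * deriv ρ.eval (1 - x))) := by
  intro x₀ hx₀
  obtain ⟨hξ0, hξ1⟩ := hξ
  obtain ⟨hx0, hxξ⟩ := hx₀
  have hbpos : 0 < b := hb ▸ ρ.integral_eval_pos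
  have hapos := lam.integral_eval_pos
  have hgap := ρ.integral_gap lam ξ
  rw [← hb] at hgap hR
  set a := ∫ x in (0:ℝ)..1, lam.eval x
  have hd := ρ.derivEval_pos (x := 1 - x₀) (by linarith)
  rw [(ρ.hasDerivAt_eval _).deriv]
  have hrw : 2 * b * dR / ((ξ + dR) * ρ.derivEval (1 - x₀)) =
      2 * (b - ξ * a) / ρ.derivEval (1 - x₀) := by
    have h1 : ξ + dR = b / a := by rw [hdR, hR]; ring
    have h2 : dR = b / a - ξ := by linarith
    rw [h1, h2]
    field_simp
  rw [hrw]
  apply Real.le_sqrt_of_sq_le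
  rw [le_div_iff₀ hd, ← hgap]
  set h : ℝ → ℝ := fun x => x - ξ * lam.eval (1 - ρ.eval (1 - x)) with hh
  change h x₀ ^ 2 * _ ≤ 2 * ∫ x in (0:ℝ)..1, h x * ρ.derivEval (1 - x)
  have hcont : Continuous h := by fun_prop
  have hf0 : ∀ x, 0 ≤ x → x ≤ 1 → 0 ≤ 1 - ρ.eval (1 - x) := fun x h0 h1 => by
    have := ρ.eval_le_eval (x := 1 - x) (y := 1) (by linarith) (by linarith)
    rw [ρ.eval_one] at this
    linarith
  have hf1 : ∀ x, 0 ≤ x → x ≤ 1 → 1 - ρ.eval (1 - x) ≤ 1 := fun x h0 h1 => by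
    have := ρ.eval_le_eval (x := 0) (y := 1 - x) le_rfl (by linarith)
    rw [ρ.eval_zero] at this
    linarith
  have hle : h x₀ ≤ x₀ := by
    have := lam.eval_le_eval le_rfl (hf0 x₀ hx0.le (by linarith))
    rw [lam.eval_zero] at this
    have := mul_nonneg hξ0.le this
    simp only [hh]; linarith
  have hpos : 0 < h x₀ := sub_pos.mpr (hdec x₀ ⟨hx0, hxξ.le⟩)
  have hnonneg : ∀ x, 0 < x → x ≤ 1 → 0 ≤ h x := fun x h0 h1 => by
    rcases le_or_gt x ξ with hx | hx
    · exact (sub_pos.mpr (hdec x ⟨h0, hx⟩)).le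
    · have := lam.eval_le_eval (hf0 x h0.le h1) (hf1 x h0.le h1)
      rw [lam.eval_one] at this
      have := mul_le_mul_of_nonneg_left this hξ0.le
      simp only [hh]; linarith
  have hslope : ∀ x, 0 ≤ x → x ≤ x₀ → h x₀ - x₀ + x ≤ h x := fun x h0 h1 => by
    have := ρ.eval_le_eval (x := 1 - x₀) (y := 1 - x) (by linarith) (by linarith)
    have := lam.eval_le_eval (hf0 x h0 (by linarith))
      (show 1 - ρ.eval (1 - x) ≤ 1 - ρ.eval (1 - x₀) by linarith)
    have := mul_le_mul_of_nonneg_left this hξ0.le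
    simp only [hh]; linarith
  have hci : Continuous fun x => h x * ρ.derivEval (1 - x) := by fun_prop
  have hint : ∫ x in (x₀ - h x₀)..x₀, (h x₀ - x₀ + x) * ρ.derivEval (1 - x₀) =
      h x₀ ^ 2 / 2 * ρ.derivEval (1 - x₀) := by
    rw [intervalIntegral.integral_mul_const, intervalIntegral.integral_add (by simp) (by simp)]
    simp only [intervalIntegral.integral_const, integral_id, smul_eq_mul]
    ring
  have hlow : ∫ x in (x₀ - h x₀)..x₀, (h x₀ - x₀ + x) * ρ.derivEval (1 - x₀) ≤
      ∫ x in (x₀ - h x₀)..x₀, h x * ρ.derivEval (1 - x) := by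
    refine intervalIntegral.integral_mono_on (by linarith)
      (Continuous.intervalIntegrable (by fun_prop) _ _) (hci.intervalIntegrable _ _) ?_
    rintro x ⟨hx1, hx2⟩
    have h3 := hslope x (by linarith) hx2
    exact mul_le_mul h3 (ρ.derivEval_le_derivEval (by linarith) (by linarith)) hd.le
      (by linarith)
  have hmono : ∫ x in (x₀ - h x₀)..x₀, h x * ρ.derivEval (1 - x) ≤
      ∫ x in (0:ℝ)..1, h x * ρ.derivEval (1 - x) := by
    refine intervalIntegral.integral_mono_interval (by linarith) (by linarith) (by linarith) ?_
      (hci.intervalIntegrable _ _)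
    refine (MeasureTheory.ae_restrict_iff' measurableSet_Ioc).mpr (.of_forall ?_)
    rintro x ⟨hx1, hx2⟩
    exact mul_nonneg (hnonneg x hx1 hx2) (ρ.derivEval_nonneg (by linarith))
  linarith
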